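/- Let L ≥ 1 and M ≥ 1 be integers, Ξ ≥ 1, e_v > 0, and N ≥ 1. Let v : ℝ×ℝ³ → ℝ³ be a smooth vector field, ℤ³-periodic in the space variable, satisfying sup_{(t,x)} ‖∇^k v(t,x)‖ ≤ Ξ^k N^{(k−L)₊/L} e_v^{1/2} for 1 ≤ k ≤ M, where ∇ denotes spatial derivatives and (x)₊ = max(x,0). Let Φ_s(t,x) = (t+s, Φ_s^i(t,x)) denote the flow of ∂_t + v·∇, i.e. (d/ds)Φ_s^i(t,x) = v^i(Φ_s(t,x)) and Φ₀(t,x) = (t,x). Then for each 1 ≤ k ≤ M there exist constants C₁ and C₂, depending only on k and L, such that for all (t,x) and all s ∈ ℝ: ‖∇_x^k Φ_s^i(t,x)‖ ≤ C₁ e^{C₂ Ξ e_v^{1/2} |s|} N^{(k−L)₊/L} Ξ^{k−1}. In particular, for |s| ≤ Ξ⁻¹ e_v^{−1/2}, ‖∇_x^k Φ_s^i(t,x)‖ ≤ C N^{(k−L)₊/L} Ξ^{k−1} with C depending only on k and L. -/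

import Mathlib

noncomputable section

open MeasureTheory

/-- Points of space ℝ³. -/
abbrev Spc : Type := Fin 3 → ℝ

/-- ℤ³-periodicity of a function on ℝ³. -/
def Per {α : Type*} (f : Spc → α) : Prop :=
  ∀ (x : Spc) (k : Fin 3 → ℤ), f (fun i => x i + (k i : ℝ)) = f x

/-- Spatial partial derivative in direction `j`. -/
def pd {E : Type*} [NormedAddCommGroup E] [NormedSpace ℝ E]
    (j : Fin 3) (f : Spc → E) (x : Spc) : E :=
  fderiv ℝ f x (Pi.single j 1)

/-- Time derivative. -/
def pt {E : Type*} [NormedAddCommGroup E] [NormedSpace ℝ E]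
    (f : ℝ → Spc → E) (t : ℝ) (x : Spc) : E :=
  deriv (fun s => f s x) t

open Set Filter Topology

set_option linter.unusedSectionVars false

section Nemytskii

variable {K : Type} [TopologicalSpace K] [CompactSpace K]
  {E F : Type} [NormedAddCommGroup E] [NormedSpace ℝ E] [NormedAddCommGroup F] [NormedSpace ℝ F]

/-- Superposition operator. -/
def nem (ι : C(K, ℝ)) (v : ℝ × E → F) (hv : Continuous v) (γ : C(K, E)) : C(K, F) :=
  ⟨fun q => v (ι q, γ q), by fun_prop⟩

theorem nem_apply (ι : C(K, ℝ)) (v : ℝ × E → F) (hv : Continuous v) (γ : C(K, E)) (q : K) :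
    nem ι v hv γ q = v (ι q, γ q) := rfl

theorem nem_continuous (ι : C(K, ℝ)) (v : ℝ × E → F) (hv : Continuous v) :
    Continuous (nem ι v hv) := by
  have h1 : nem ι v hv = fun γ => (ContinuousMap.mk v hv).comp (ι.prodMk γ) := rfl
  rw [h1]
  refine (ContinuousMap.continuous_postcomp _).comp ?_
  refine ContinuousMap.continuous_of_continuous_uncurry _ ?_
  have : Continuous fun p : C(K, E) × K => (ι p.2, p.1 p.2) := by fun_prop
  exact this

/-- Pointwise application as a continuous bilinear map. -/
def ptApp : C(K, E →L[ℝ] F) →L[ℝ] C(K, E) →L[ℝ] C(K, F) :=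
  LinearMap.mkContinuous₂
    (LinearMap.mk₂ ℝ (fun (A : C(K, E →L[ℝ] F)) (η : C(K, E)) =>
      (⟨fun q => A q (η q), by fun_prop⟩ : C(K, F)))
      (by intros; ext; simp) (by intros; ext; simp) (by intros; ext; simp) (by intros; ext; simp))
    1 (by
      intro A η
      rw [ContinuousMap.norm_le _ (by positivity)]
      intro q
      simp only [LinearMap.mk₂_apply, ContinuousMap.coe_mk, one_mul]
      exact ((A q).le_opNorm _).trans (by gcongr <;> exact ContinuousMap.norm_coe_le_norm _ _))

theorem ptApp_apply (A : C(K, E →L[ℝ] F)) (η : C(K, E)) (q : K) :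
    ptApp A η q = A q (η q) := rfl

/-- Spatial derivative. -/
def spd (v : ℝ × E → F) (p : ℝ × E) : E →L[ℝ] F := (fderiv ℝ v p).comp (ContinuousLinearMap.inr ℝ ℝ E)

theorem spd_contDiff {v : ℝ × E → F} (hv : ContDiff ℝ (⊤ : ℕ∞) v) :
    ContDiff ℝ (⊤ : ℕ∞) (spd v) := by
  have := hv.fderiv_right (m := (⊤ : ℕ∞)) (by simp)
  exact this.clm_comp contDiff_const

theorem spd_hasFDerivAt {v : ℝ × E → F} (hv : ContDiff ℝ (⊤ : ℕ∞) v) (t : ℝ) (x : E) :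
    HasFDerivAt (fun y => v (t, y)) (spd v (t, x)) x := by
  have h1 : HasFDerivAt v (fderiv ℝ v (t, x)) (t, x) :=
    (hv.differentiable (by simp)).differentiableAt.hasFDerivAt
  exact h1.comp x (hasFDerivAt_prodMk_right t x)

theorem nem_hasFDerivAt (ι : C(K, ℝ)) {v : ℝ × E → F} (hv : ContDiff ℝ (⊤ : ℕ∞) v) (γ : C(K, E)) :
    HasFDerivAt (nem ι v hv.continuous)
      (ptApp (nem ι (spd v) (spd_contDiff hv).continuous γ)) γ := by
  rw [hasFDerivAt_iff_isLittleO_nhds_zero, Asymptotics.isLittleO_iff]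
  intro c hc
  have hcont := (nem_continuous ι (spd v) (spd_contDiff hv).continuous).tendsto γ
  rw [Metric.tendsto_nhds_nhds] at hcont
  obtain ⟨δ, hδ, h⟩ := hcont c hc
  filter_upwards [Metric.ball_mem_nhds (0 : C(K, E)) hδ] with η hη
  rw [ContinuousMap.norm_le _ (by positivity)]
  intro q
  simp only [ContinuousMap.sub_apply, nem_apply, ptApp_apply, ContinuousMap.add_apply]
  have key := (convex_segment (γ q) (γ q + η q)).norm_image_sub_le_of_norm_hasFDerivWithin_le'
    (f := fun y => v (ι q, y)) (f' := fun y => spd v (ι q, y)) (C := c) (φ := spd v (ι q, γ q))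
    (x := γ q) (y := γ q + η q)
    (fun y _ => (spd_hasFDerivAt hv _ y).hasFDerivWithinAt) ?_
    (left_mem_segment ℝ _ _) (right_mem_segment ℝ _ _)
  · simp only [add_sub_cancel_left] at key
    exact key.trans (by gcongr; exact ContinuousMap.norm_coe_le_norm _ _)
  · intro y hy
    rw [segment_eq_image'] at hy
    obtain ⟨θ, hθ, rfl⟩ := hy
    have h2 := h (x := γ + θ • η) (by
      rw [dist_eq_norm, add_sub_cancel_left, norm_smul, Real.norm_eq_abs, abs_of_nonneg hθ.1]
      rw [mem_ball_zero_iff] at hη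
      nlinarith [norm_nonneg η, hθ.2])
    rw [dist_eq_norm] at h2
    have h3 := (ContinuousMap.norm_coe_le_norm _ q).trans h2.le
    simpa [nem_apply] using h3

end Nemytskii

theorem nem_contDiff_nat {K : Type} [TopologicalSpace K] [CompactSpace K] (ι : C(K, ℝ))
    {E : Type} [NormedAddCommGroup E] [NormedSpace ℝ E] (n : ℕ) :
    ∀ {F : Type} [NormedAddCommGroup F] [NormedSpace ℝ F]
    {v : ℝ × E → F} (hv : ContDiff ℝ (⊤ : ℕ∞) v),
    ContDiff ℝ n (nem ι v hv.continuous) := by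
  induction n with
  | zero =>
    intro F _ _ v hv
    exact contDiff_zero.2 (nem_continuous _ _ _)
  | succ n ih =>
    intro F _ _ v hv
    push_cast
    rw [contDiff_succ_iff_hasFDerivAt]
    refine ⟨fun γ => ptApp (nem ι (spd v) (spd_contDiff hv).continuous γ), ?_,
      fun γ => nem_hasFDerivAt ι hv γ⟩
    exact (ptApp (K := K) (E := E) (F := F)).contDiff.comp (ih (spd_contDiff hv))

theorem nem_contDiff {K : Type} [TopologicalSpace K] [CompactSpace K] (ι : C(K, ℝ))
    {E : Type} [NormedAddCommGroup E] [NormedSpace ℝ E]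
    {F : Type} [NormedAddCommGroup F] [NormedSpace ℝ F]
    {v : ℝ × E → F} (hv : ContDiff ℝ (⊤ : ℕ∞) v) :
    ContDiff ℝ (⊤ : ℕ∞) (nem ι v hv.continuous) :=
  contDiff_infty.2 fun n => nem_contDiff_nat ι n hv

section Volterra

variable {E : Type} [NormedAddCommGroup E] [NormedSpace ℝ E] [CompleteSpace E]

/-- The Volterra integration operator on `C([-δ, δ], E)`. -/
def volt (δ : ℝ) (hδ : -δ ≤ δ) : C(Icc (-δ) δ, E) →L[ℝ] C(Icc (-δ) δ, E) :=
  LinearMap.mkContinuous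
    { toFun := fun f => ⟨fun σ => ∫ τ in (0 : ℝ)..σ, IccExtend hδ f τ, by
        have h : Continuous (IccExtend hδ f) := f.continuous.Icc_extend'
        exact (intervalIntegral.continuous_primitive
          (fun a b => h.intervalIntegrable a b) 0).comp continuous_subtype_val⟩
      map_add' := by
        intro f g
        ext σ
        have hf : Continuous (IccExtend hδ f) := f.continuous.Icc_extend'
        have hg : Continuous (IccExtend hδ g) := g.continuous.Icc_extend'
        simp only [ContinuousMap.coe_mk, ContinuousMap.add_apply]
        rw [← intervalIntegral.integral_add (hf.intervalIntegrable _ _) (hg.intervalIntegrable _ _)]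
        rfl
      map_smul' := by
        intro c f
        ext σ
        simp only [ContinuousMap.coe_mk, ContinuousMap.smul_apply, RingHom.id_apply]
        rw [← intervalIntegral.integral_smul]
        rfl }
    δ (by
      intro f
      have hδ0 : 0 ≤ δ := by linarith
      rw [ContinuousMap.norm_le _ (by positivity)]
      intro σ
      simp only [LinearMap.coe_mk, AddHom.coe_mk, ContinuousMap.coe_mk]
      refine (intervalIntegral.norm_integral_le_of_norm_le_const (C := ‖f‖) ?_).trans ?_
      · intro τ _
        exact ContinuousMap.norm_coe_le_norm f _
      · rw [mul_comm]
        gcongr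
        rw [sub_zero, abs_le]
        exact σ.2)

theorem volt_apply (δ : ℝ) (hδ : -δ ≤ δ) (f : C(Icc (-δ) δ, E)) (σ : Icc (-δ) δ) :
    volt δ hδ f σ = ∫ τ in (0 : ℝ)..σ, IccExtend hδ f τ := rfl

theorem volt_norm_le (δ : ℝ) (hδ : -δ ≤ δ) : ‖volt (E := E) δ hδ‖ ≤ δ :=
  LinearMap.mkContinuous_norm_le _ (by linarith) _

end Volterra

section Flow

variable {E : Type} [NormedAddCommGroup E] [NormedSpace ℝ E] [CompleteSpace E]

theorem nem_lip {K : Type} [TopologicalSpace K] [CompactSpace K] (ι : C(K, ℝ))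
    {v : ℝ × E → E} (hv : ContDiff ℝ (⊤ : ℕ∞) v) {Λ : ℝ} (hΛ0 : 0 ≤ Λ)
    (hΛ : ∀ p, ‖spd v p‖ ≤ Λ) (γ γ' : C(K, E)) :
    ‖nem ι v hv.continuous γ - nem ι v hv.continuous γ'‖ ≤ Λ * ‖γ - γ'‖ := by
  rw [ContinuousMap.norm_le _ (by positivity)]
  intro q
  have key := (convex_univ (𝕜 := ℝ) (E := E)).norm_image_sub_le_of_norm_hasFDerivWithin_le
    (f := fun y => v (ι q, y)) (f' := fun y => spd v (ι q, y)) (C := Λ)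
    (x := γ' q) (y := γ q)
    (fun y _ => (spd_hasFDerivAt hv _ y).hasFDerivWithinAt) (fun y _ => hΛ _)
    (mem_univ _) (mem_univ _)
  refine key.trans ?_
  gcongr
  have hq := ContinuousMap.norm_coe_le_norm (γ - γ') q
  exact hq.trans (le_of_eq rfl)

/-- The map whose inverse is the local flow. -/
def hmap (δ : ℝ) (hδ : -δ ≤ δ) (ι : C(Icc (-δ) δ, ℝ)) (v : ℝ × E → E) (hv : Continuous v)
    (γ : C(Icc (-δ) δ, E)) : C(Icc (-δ) δ, E) :=
  γ - volt δ hδ (nem ι v hv γ)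

theorem hmap_contDiff (δ : ℝ) (hδ : -δ ≤ δ) (ι : C(Icc (-δ) δ, ℝ)) {v : ℝ × E → E}
    (hv : ContDiff ℝ (⊤ : ℕ∞) v) : ContDiff ℝ (⊤ : ℕ∞) (hmap δ hδ ι v hv.continuous) :=
  contDiff_id.sub (ContDiff.comp (g := ⇑(volt (E := E) δ hδ)) (volt (E := E) δ hδ).contDiff (nem_contDiff ι hv))

theorem hmap_antilip (δ : ℝ) (hδ : -δ ≤ δ) (ι : C(Icc (-δ) δ, ℝ)) {v : ℝ × E → E}
    (hv : ContDiff ℝ (⊤ : ℕ∞) v) {Λ : ℝ} (hΛ0 : 0 ≤ Λ)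
    (hΛ : ∀ p, ‖spd v p‖ ≤ Λ) (hs : δ * Λ ≤ 1 / 2) (γ γ' : C(Icc (-δ) δ, E)) :
    ‖γ - γ'‖ ≤ 2 * ‖hmap δ hδ ι v hv.continuous γ - hmap δ hδ ι v hv.continuous γ'‖ := by
  have h1 := nem_lip ι hv hΛ0 hΛ γ γ'
  have h2 := (volt (E := E) δ hδ).le_opNorm
    (nem ι v hv.continuous γ - nem ι v hv.continuous γ')
  have h3 := volt_norm_le (E := E) δ hδ
  have h4 : γ - γ' = (hmap δ hδ ι v hv.continuous γ - hmap δ hδ ι v hv.continuous γ') +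
      volt δ hδ (nem ι v hv.continuous γ - nem ι v hv.continuous γ') := by
    simp only [hmap, map_sub]; abel
  have h5 := norm_add_le (hmap δ hδ ι v hv.continuous γ - hmap δ hδ ι v hv.continuous γ')
      (volt δ hδ (nem ι v hv.continuous γ - nem ι v hv.continuous γ'))
  rw [← h4] at h5
  have hδ0 : 0 ≤ δ := by linarith
  have h6 : ‖volt (E := E) δ hδ‖ * ‖nem ι v hv.continuous γ - nem ι v hv.continuous γ'‖ ≤
      δ * (Λ * ‖γ - γ'‖) := by gcongr
  nlinarith [norm_nonneg (γ - γ')]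

theorem ptApp_norm_le {K : Type} [TopologicalSpace K] [CompactSpace K]
    (A : C(K, E →L[ℝ] E)) {Λ : ℝ} (hΛ0 : 0 ≤ Λ) (h : ∀ q, ‖A q‖ ≤ Λ) : ‖ptApp A‖ ≤ Λ := by
  refine ContinuousLinearMap.opNorm_le_bound _ hΛ0 fun η => ?_
  rw [ContinuousMap.norm_le _ (by positivity)]
  intro q
  rw [ptApp_apply]
  refine ((A q).le_opNorm _).trans ?_
  gcongr
  · exact h q
  · exact ContinuousMap.norm_coe_le_norm _ _

theorem hmap_deriv (δ : ℝ) (hδ : -δ ≤ δ) (ι : C(Icc (-δ) δ, ℝ)) {v : ℝ × E → E}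
    (hv : ContDiff ℝ (⊤ : ℕ∞) v) {Λ : ℝ} (hΛ0 : 0 ≤ Λ)
    (hΛ : ∀ p, ‖spd v p‖ ≤ Λ) (hs : δ * Λ ≤ 1 / 2) (γ : C(Icc (-δ) δ, E)) :
    ∃ e : C(Icc (-δ) δ, E) ≃L[ℝ] C(Icc (-δ) δ, E),
      HasFDerivAt (hmap δ hδ ι v hv.continuous)
        (e : C(Icc (-δ) δ, E) →L[ℝ] C(Icc (-δ) δ, E)) γ := by
  set T := (volt δ hδ).comp (ptApp (nem ι (spd v) (spd_contDiff hv).continuous γ)) with hT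
  have hδ0 : 0 ≤ δ := by linarith
  have hTn : ‖T‖ < 1 := by
    have h1 := ContinuousLinearMap.opNorm_comp_le (volt δ hδ)
      (ptApp (nem ι (spd v) (spd_contDiff hv).continuous γ))
    have h2 := volt_norm_le (E := E) δ hδ
    have h3 := ptApp_norm_le (nem ι (spd v) (spd_contDiff hv).continuous γ) hΛ0 (fun q => hΛ _)
    have : ‖volt (E := E) δ hδ‖ * ‖ptApp (nem ι (spd v) (spd_contDiff hv).continuous γ)‖ ≤ δ * Λ := by
      gcongr
    linarith
  obtain ⟨u, hu⟩ := isUnit_one_sub_of_norm_lt_one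
    (R := C(Icc (-δ) δ, E) →L[ℝ] C(Icc (-δ) δ, E)) (x := T) hTn
  refine ⟨ContinuousLinearEquiv.ofUnit u, ?_⟩
  have h4 : HasFDerivAt (hmap δ hδ ι v hv.continuous)
      (ContinuousLinearMap.id ℝ _ - T) γ :=
    (hasFDerivAt_id γ).sub ((volt (E := E) δ hδ).hasFDerivAt.comp γ (nem_hasFDerivAt ι hv γ))
  convert h4 using 1
  exact hu

/-- Translation of time. -/
def tshift (δ a : ℝ) : C(Icc (-δ) δ, ℝ) := ⟨fun σ => a + σ, by fun_prop⟩

/-- The curve traced by the flow, as an element of a space of continuous functions. -/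
def cur (δ s : ℝ) (P : ℝ → E → E) (hP : ∀ x, Continuous fun s => P s x) (x : E) :
    C(Icc (-δ) δ, E) :=
  ⟨fun σ => P (s + σ) x, by have := hP x; fun_prop⟩

theorem hmap_cur (δ : ℝ) (hδ : -δ ≤ δ) (t s : ℝ) {v : ℝ × E → E}
    (hv : ContDiff ℝ (⊤ : ℕ∞) v) (P : ℝ → E → E) (hP : ∀ x, Continuous fun s => P s x)
    (hd : ∀ s x, HasDerivAt (fun s' => P s' x) (v (t + s, P s x)) s) (x : E) :
    hmap δ hδ (tshift δ (t + s)) v hv.continuous (cur δ s P hP x) =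
      ContinuousMap.const _ (P s x) := by
  ext σ
  have hc := hP x
  have hvc := hv.continuous
  have h1 : ∫ τ in (0 : ℝ)..σ, v (t + (s + τ), P (s + τ) x) = P (s + σ) x - P (s + 0) x := by
    refine intervalIntegral.integral_eq_sub_of_hasDerivAt (f := fun τ => P (s + τ) x) ?_ ?_
    · intro τ _
      exact (hd (s + τ) x).comp_const_add s τ
    · apply Continuous.intervalIntegrable
      fun_prop
  have h2 : ∫ τ in (0 : ℝ)..σ, IccExtend hδ
      (nem (tshift δ (t + s)) v hv.continuous (cur δ s P hP x)) τ =
      ∫ τ in (0 : ℝ)..σ, v (t + (s + τ), P (s + τ) x) := by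
    refine intervalIntegral.integral_congr fun τ hτ => ?_
    have hτ' : τ ∈ Icc (-δ) δ := by
      have h0 : (0 : ℝ) ∈ Icc (-δ) δ := ⟨by linarith, by linarith⟩
      exact (ordConnected_Icc.uIcc_subset h0 σ.2) hτ
    simp only [IccExtend_of_mem hδ _ hτ', nem_apply, tshift, cur, ContinuousMap.coe_mk]
    rw [add_assoc]
  simp only [hmap, ContinuousMap.sub_apply, volt_apply, h2, h1, ContinuousMap.const_apply]
  simp [cur]

theorem cur_contDiff (δ : ℝ) (hδ : -δ ≤ δ) (t s : ℝ) {v : ℝ × E → E}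
    (hv : ContDiff ℝ (⊤ : ℕ∞) v) {Λ : ℝ} (hΛ0 : 0 ≤ Λ)
    (hΛ : ∀ p, ‖spd v p‖ ≤ Λ) (hs : δ * Λ ≤ 1 / 2)
    (P : ℝ → E → E) (hP : ∀ x, Continuous fun s => P s x)
    (hd : ∀ s x, HasDerivAt (fun s' => P s' x) (v (t + s, P s x)) s)
    (hsm : ContDiff ℝ (⊤ : ℕ∞) (P s)) : ContDiff ℝ (⊤ : ℕ∞) (cur δ s P hP) := by
  have hH := hmap_cur δ hδ t s hv P hP hd
  let cst : E →L[ℝ] C(Icc (-δ) δ, E) := ContinuousLinearMap.const ℝ _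
  have hcst : ∀ y, cst y = ContinuousMap.const _ y := fun y => rfl
  have hcont : Continuous (cur δ s P hP) := by
    rw [continuous_iff_continuousAt]
    intro x
    have h1 : Tendsto (fun y => 2 * ‖cst (P s y) - cst (P s x)‖) (𝓝 x) (𝓝 0) := by
      have : Continuous (fun y => 2 * ‖cst (P s y) - cst (P s x)‖) := by
        have := hsm.continuous
        fun_prop
      simpa using this.tendsto x
    rw [ContinuousAt, tendsto_iff_norm_sub_tendsto_zero]
    refine squeeze_zero (fun _ => norm_nonneg _) (fun y => ?_) h1
    have := hmap_antilip δ hδ (tshift δ (t + s)) hv hΛ0 hΛ hs (cur δ s P hP y) (cur δ s P hP x)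
    rwa [hH, hH] at this
  rw [contDiff_iff_contDiffAt]
  intro x
  obtain ⟨e, he⟩ := hmap_deriv δ hδ (tshift δ (t + s)) hv hΛ0 hΛ hs (cur δ s P hP x)
  have hc := (hmap_contDiff δ hδ (tshift δ (t + s)) hv).contDiffAt (x := cur δ s P hP x)
  have hn : ((⊤ : ℕ∞) : WithTop ℕ∞) ≠ 0 := by simp
  have hinv := hc.to_localInverse he hn
  have hev := (hc.hasStrictFDerivAt' he hn).eventually_left_inverse
  have hev2 := (hcont.tendsto x).eventually hev
  rw [hH] at hinv
  have hcomp : ContDiffAt ℝ (⊤ : ℕ∞) (fun y => hc.localInverse he hn (cst (P s y))) x :=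
    ContDiffAt.comp x (g := hc.localInverse he hn) (f := fun y => cst (P s y)) hinv
      (cst.contDiff.comp hsm).contDiffAt
  refine hcomp.congr_of_eventuallyEq ?_
  filter_upwards [hev2] with y hy
  rw [hcst, ← hH]
  exact hy.symm

theorem flow_contDiff (t : ℝ) {v : ℝ × E → E}
    (hv : ContDiff ℝ (⊤ : ℕ∞) v) {Λ : ℝ} (hΛ0 : 0 < Λ)
    (hΛ : ∀ p, ‖spd v p‖ ≤ Λ)
    (P : ℝ → E → E) (hP0 : ∀ x, P 0 x = x)
    (hd : ∀ s x, HasDerivAt (fun s' => P s' x) (v (t + s, P s x)) s) (s : ℝ) :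
    ContDiff ℝ (⊤ : ℕ∞) (P s) := by
  have hP : ∀ x, Continuous fun s => P s x := fun x =>
    continuous_iff_continuousAt.2 fun s => (hd s x).continuousAt
  set δ := 1 / (2 * Λ) with hδd
  have hδ0 : 0 < δ := by positivity
  have hδ : -δ ≤ δ := by linarith
  have hs : δ * Λ ≤ 1 / 2 := by rw [hδd]; field_simp; norm_num
  have main : ∀ n : ℕ, ∀ s, |s| ≤ n * δ → ContDiff ℝ (⊤ : ℕ∞) (P s) := by
    intro n
    induction n with
    | zero =>
      intro s hs
      have : s = 0 := by simpa using hs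
      subst this
      have : P 0 = id := funext hP0
      rw [this]; exact contDiff_id
    | succ n ih =>
      intro s hs'
      push_cast at hs'
      obtain ⟨a, σ, ha, hσ, rfl⟩ : ∃ a σ, |a| ≤ n * δ ∧ σ ∈ Icc (-δ) δ ∧ a + σ = s := by
        refine ⟨s * (n / (n + 1)), s * (1 / (n + 1)), ?_, ?_, by field_simp⟩
        · rw [abs_mul, abs_of_nonneg (a := (n / (n + 1) : ℝ)) (by positivity)]
          calc |s| * (n / (n + 1) : ℝ) ≤ ((n + 1) * δ) * (n / (n + 1) : ℝ) := by gcongr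
            _ = n * δ := by field_simp
        · rw [mem_Icc, ← abs_le, abs_mul, abs_of_nonneg (a := (1 / (n + 1) : ℝ)) (by positivity)]
          calc |s| * (1 / (n + 1) : ℝ) ≤ ((n + 1) * δ) * (1 / (n + 1) : ℝ) := by gcongr
            _ = δ := by field_simp
      have hc := cur_contDiff δ hδ t a hv hΛ0.le hΛ hs P hP hd (ih a ha)
      exact (ContinuousMap.evalCLM ℝ (⟨σ, hσ⟩ : Icc (-δ) δ)).contDiff.comp hc
  obtain ⟨n, hn⟩ := exists_nat_ge (|s| / δ)
  exact main n s ((div_le_iff₀ hδ0).1 hn)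

theorem flow_iter_hasDerivAt (t : ℝ) {v : ℝ × E → E}
    (hv : ContDiff ℝ (⊤ : ℕ∞) v) {Λ : ℝ} (hΛ0 : 0 < Λ)
    (hΛ : ∀ p, ‖spd v p‖ ≤ Λ)
    (P : ℝ → E → E) (hP0 : ∀ x, P 0 x = x)
    (hd : ∀ s x, HasDerivAt (fun s' => P s' x) (v (t + s, P s x)) s) (s : ℝ)
    (k : ℕ) (x : E) (m : Fin k → E) :
    HasDerivAt (fun s' => iteratedFDeriv ℝ k (P s') x m)
      (iteratedFDeriv ℝ k ((fun y => v (t + s, y)) ∘ P s) x m) s := by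
  have hP : ∀ x, Continuous fun s => P s x := fun x =>
    continuous_iff_continuousAt.2 fun s => (hd s x).continuousAt
  set δ := 1 / (2 * Λ) with hδd
  have hδ0 : 0 < δ := by positivity
  have hδ : -δ ≤ δ := by linarith
  have hs : δ * Λ ≤ 1 / 2 := by rw [hδd]; field_simp; norm_num
  have hsm := flow_contDiff t hv hΛ0 hΛ P hP0 hd s
  have hc := cur_contDiff δ hδ t s hv hΛ0.le hΛ hs P hP hd hsm
  have hnc : ContDiff ℝ (⊤ : ℕ∞) (fun y => nem (tshift δ (t + s)) v hv.continuous (cur δ s P hP y)) :=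
    (nem_contDiff (tshift δ (t + s)) hv).comp hc
  set A := iteratedFDeriv ℝ k
    (fun y => nem (tshift δ (t + s)) v hv.continuous (cur δ s P hP y)) x with hA
  have hk : ((k : ℕ) : WithTop ℕ∞) ≤ ((⊤ : ℕ∞) : WithTop ℕ∞) := by
    exact_mod_cast le_top
  have hAev : ∀ σ : Icc (-δ) δ, (A m) σ =
      iteratedFDeriv ℝ k ((fun y => v (t + s + σ, y)) ∘ P (s + σ)) x m := by
    intro σ
    have := (ContinuousMap.evalCLM ℝ σ).iteratedFDeriv_comp_left (hnc.contDiffAt (x := x)) hk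
    have h2 := congrArg (fun B => B m) this
    exact h2.symm
  have hmain : ∀ σ (hσ : σ ∈ Icc (-δ) δ), iteratedFDeriv ℝ k (P (s + σ)) x m =
      iteratedFDeriv ℝ k (P s) x m + ∫ τ in (0 : ℝ)..σ, IccExtend hδ (A m) τ := by
    intro σ hσ
    have h1 : P (s + σ) = P s + (((ContinuousMap.evalCLM ℝ (⟨σ, hσ⟩ : Icc (-δ) δ)).comp
        (volt δ hδ)) ∘
        (fun y => nem (tshift δ (t + s)) v hv.continuous (cur δ s P hP y))) := by
      funext y
      have h := congrArg (fun g : C(Icc (-δ) δ, E) => g ⟨σ, hσ⟩) (hmap_cur δ hδ t s hv P hP hd y)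
      simp only [hmap, ContinuousMap.sub_apply, ContinuousMap.const_apply] at h
      rw [sub_eq_iff_eq_add] at h
      exact h
    rw [h1, iteratedFDeriv_add (hsm.of_le hk)
      ((((ContinuousMap.evalCLM ℝ (⟨σ, hσ⟩ : Icc (-δ) δ)).comp
        (volt δ hδ)).contDiff.comp hnc).of_le hk)]
    rw [Pi.add_apply]
    rw [add_apply,
      ContinuousLinearMap.iteratedFDeriv_comp_left _ (hnc.contDiffAt (x := x)) hk]
    rfl
  have h0 : (0 : ℝ) ∈ Icc (-δ) δ := ⟨by linarith, by linarith⟩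
  have hcA : Continuous (IccExtend hδ (A m)) := (A m).continuous.Icc_extend'
  have hder : HasDerivAt (fun σ => iteratedFDeriv ℝ k (P s) x m +
      ∫ τ in (0 : ℝ)..σ, IccExtend hδ (A m) τ) (IccExtend hδ (A m) 0) 0 := by
    refine HasDerivAt.const_add _ ?_
    exact intervalIntegral.integral_hasDerivAt_right (hcA.intervalIntegrable _ _)
      (hcA.stronglyMeasurableAtFilter _ _) hcA.continuousAt
  have hder2 : HasDerivAt (fun σ => iteratedFDeriv ℝ k (P (s + σ)) x m)
      (IccExtend hδ (A m) 0) 0 := by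
    refine hder.congr_of_eventuallyEq ?_
    filter_upwards [Icc_mem_nhds (neg_lt_zero.2 hδ0) hδ0] with σ hσ
    exact hmain σ hσ
  rw [IccExtend_of_mem hδ _ h0, hAev] at hder2
  simp only [add_zero] at hder2
  have h3 := HasDerivAt.comp_sub_const s s (f := fun σ => iteratedFDeriv ℝ k (P (s + σ)) x m)
    (by simpa using hder2)
  simpa using h3

end Flow

section Bounds

theorem ofp_sum {n : ℕ} (c : OrderedFinpartition n) : ∑ i, c.partSize i = n := by
  have := c.sum_sigma_eq_sum (fun _ => (1 : ℕ))
  simpa using this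

theorem ofp_single {n : ℕ} (c : OrderedFinpartition n) (h : c.length = 1)
    {E F : Type} [NormedAddCommGroup E] [NormedSpace ℝ E] [NormedAddCommGroup F] [NormedSpace ℝ F]
    (p : FormalMultilinearSeries ℝ E F) (m : Fin n → E) (i : Fin c.length) :
    p (c.partSize i) (m ∘ c.emb i) = p n m := by
  have hall : ∀ (j : ℕ) (e : Fin j → Fin n), StrictMono e → j = n → p j (m ∘ e) = p n m := by
    intro j e he hj
    subst hj
    have : e = id := by
      refine (StrictMono.range_inj he strictMono_id).1 ?_
      rw [range_id]; exact (Finite.injective_iff_surjective.1 he.injective).range_eq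
    rw [this]; rfl
  refine hall _ _ (c.emb_strictMono i) ?_
  have hs := ofp_sum c
  have : ∀ j : Fin c.length, j = i := fun j => by
    apply Fin.ext; have := j.2; have := i.2; omega
  rw [Finset.sum_eq_single i (fun j _ hj => absurd (this j) hj) (by simp)] at hs
  exact hs

theorem ofp_lt {n : ℕ} (c : OrderedFinpartition n) (h : 2 ≤ c.length) (i : Fin c.length) :
    c.partSize i < n := by
  have hs := ofp_sum c
  obtain ⟨j, hj⟩ : ∃ j : Fin c.length, j ≠ i := by
    have : Nontrivial (Fin c.length) := Fin.nontrivial_iff_two_le.2 h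
    exact exists_ne i
  have h1 : c.partSize j + c.partSize i ≤ ∑ i, c.partSize i := by
    rw [← Finset.sum_pair hj]
    exact Finset.sum_le_sum_of_subset (Finset.subset_univ _)
  have := c.partSize_pos j
  omega

theorem gron_pos {E : Type} [NormedAddCommGroup E] [NormedSpace ℝ E] (f f' : ℝ → E)
    {K ε b S : ℝ} (hK : 0 < K) (hε : 0 ≤ ε)
    (hd : ∀ s, HasDerivAt f (f' s) s) (h0 : ‖f 0‖ ≤ b) (hS : 0 ≤ S)
    (hb : ∀ s, |s| ≤ S → ‖f' s‖ ≤ K * ‖f s‖ + ε) :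
    ‖f S‖ ≤ (b + ε / K) * Real.exp (K * S) := by
  have := norm_le_gronwallBound_of_norm_deriv_right_le (f := f) (f' := f') (a := 0) (b := S)
    (δ := b) (K := K) (ε := ε)
    (fun s _ => (hd s).continuousAt.continuousWithinAt)
    (fun s _ => (hd s).hasDerivWithinAt) h0
    (fun s hs => hb s (by rw [abs_of_nonneg hs.1]; exact hs.2.le)) S ⟨hS, le_rfl⟩
  rw [gronwallBound_of_K_ne_0 hK.ne', sub_zero] at this
  have h2 : 0 ≤ ε / K := by positivity
  nlinarith

theorem gron {E : Type} [NormedAddCommGroup E] [NormedSpace ℝ E] (f f' : ℝ → E)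
    {K ε b : ℝ} (s : ℝ) (hK : 0 < K) (hε : 0 ≤ ε)
    (hd : ∀ s, HasDerivAt f (f' s) s) (h0 : ‖f 0‖ ≤ b)
    (hb : ∀ s', |s'| ≤ |s| → ‖f' s'‖ ≤ K * ‖f s'‖ + ε) :
    ‖f s‖ ≤ (b + ε / K) * Real.exp (K * |s|) := by
  rcases le_total 0 s with hs | hs
  · have := gron_pos f f' hK hε hd h0 (abs_nonneg s) hb
    rwa [abs_of_nonneg hs] at this ⊢
  · have := gron_pos (fun s => f (-s)) (fun s => -f' (-s)) hK hε (fun s => by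
      have := (hd (-s)).scomp s (hasDerivAt_neg s)
      simpa [Function.comp_def] using this) (by simpa using h0) (abs_nonneg s) (fun s' hs' => by
        simpa using hb (-s') (by simpa using hs'))
    rw [abs_of_nonpos hs] at this ⊢
    simpa using this

theorem iter_id_le {E : Type} [NormedAddCommGroup E] [NormedSpace ℝ E] (n : ℕ) (hn : 1 ≤ n)
    (x : E) : ‖iteratedFDeriv ℝ n (fun y : E => y) x‖ ≤ 1 := by
  obtain ⟨k, rfl⟩ : ∃ k, n = k + 1 := ⟨n - 1, by omega⟩
  rw [← norm_iteratedFDeriv_fderiv]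
  have : fderiv ℝ (fun y : E => y) = fun _ => ContinuousLinearMap.id ℝ E := by
    funext y; exact fderiv_fun_id
  rw [this]
  rcases k with _ | k
  · rw [norm_iteratedFDeriv_zero]
    exact ContinuousLinearMap.norm_id_le
  · rw [iteratedFDeriv_const_of_ne (by omega)]
    simp

theorem abs_bound {E : Type} [NormedAddCommGroup E] [NormedSpace ℝ E] [CompleteSpace E] (k : ℕ) :
    ∃ C : ℝ, 1 ≤ C ∧ ∀ (W : ℕ → ℝ) (a : ℝ) (v : ℝ × E → E), 0 < a → W 1 = 1 → (∀ j, 1 ≤ W j) →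
      (∀ n, 1 ≤ n → ∀ c : OrderedFinpartition n, W c.length * ∏ i, W (c.partSize i) ≤ W n) →
      ContDiff ℝ (⊤ : ℕ∞) v →
      (∀ j, 1 ≤ j → j ≤ k → ∀ t x, ‖iteratedFDeriv ℝ j (fun y => v (t, y)) x‖ ≤ a * W j) →
      ∀ (t : ℝ) (P : ℝ → E → E), (∀ x, P 0 x = x) →
      (∀ s x, HasDerivAt (fun s' => P s' x) (v (t + s, P s x)) s) →
      ∀ j, 1 ≤ j → j ≤ k → ∀ s x,
        ‖iteratedFDeriv ℝ j (P s) x‖ ≤ C * Real.exp (C * a * |s|) * W j := by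
  induction k with
  | zero => exact ⟨1, le_rfl, by intros; omega⟩
  | succ k ih =>
    obtain ⟨C, hC1, hC⟩ := ih
    set n := k + 1 with hn
    set Q : ℝ := (Fintype.card (OrderedFinpartition n) : ℝ) with hQ
    have hQ0 : 0 < Q := by
      have : 0 < Fintype.card (OrderedFinpartition n) :=
        Fintype.card_pos_iff.2 ⟨OrderedFinpartition.atomic n⟩
      rw [hQ]; exact_mod_cast this
    have hCn : 1 ≤ C ^ n := one_le_pow₀ hC1
    have hCCn : C ≤ C ^ n := le_self_pow₀ hC1 (by omega)
    set C' : ℝ := 2 * C ^ n + n * C + Q with hC'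
    have hnC : 0 ≤ (n : ℝ) * C := by positivity
    have hCC' : C ≤ C' := by rw [hC']; linarith
    refine ⟨C', hC1.trans hCC', ?_⟩
    intro W a v ha hW1 hW hsub hv hvb t P hP0 hd j hj1 hj s x
    have hW0 : ∀ j, 0 < W j := fun j => lt_of_lt_of_le one_pos (hW j)
    have hprev := hC W a v ha hW1 hW hsub hv (fun j h1 h2 => hvb j h1 (by omega)) t P hP0 hd
    rcases Nat.lt_or_ge j n with hlt | hge
    · refine (hprev j hj1 (by omega) s x).trans ?_
      have := hW0 j
      gcongr
    obtain rfl : j = n := le_antisymm hj hge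
    have hΛ : ∀ p, ‖spd v p‖ ≤ a := by
      rintro ⟨t, x⟩
      have h1 := hvb 1 le_rfl hj1 t x
      rw [norm_iteratedFDeriv_one, (spd_hasFDerivAt hv t x).fderiv, hW1, mul_one] at h1
      exact h1
    have hsm := flow_contDiff t hv ha hΛ P hP0 hd
    have hk : ((n : ℕ) : WithTop ℕ∞) ≤ ((⊤ : ℕ∞) : WithTop ℕ∞) := by
      exact_mod_cast le_top
    set G := C * Real.exp (C * a * |s|) with hG
    have hG1 : 1 ≤ G := by
      have : 1 ≤ Real.exp (C * a * |s|) := Real.one_le_exp (by positivity)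
      rw [hG]; nlinarith
    refine ContinuousMultilinearMap.opNorm_le_bound (by have := hW0 n; positivity) fun m => ?_
    set pm := ∏ i, ‖m i‖ with hpm
    have hpm0 : 0 ≤ pm := Finset.prod_nonneg fun i _ => norm_nonneg _
    set ε0 := a * (G ^ n * W n) * pm with hε0
    have hε00 : 0 ≤ ε0 := by have := hW0 n; positivity
    have hbound : ∀ s', |s'| ≤ |s| →
        ‖iteratedFDeriv ℝ n ((fun y => v (t + s', y)) ∘ P s') x m‖ ≤
          (Q * a) * ‖iteratedFDeriv ℝ n (P s') x m‖ + Q * ε0 := by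
      intro s' hs'
      have hvs : ContDiff ℝ (⊤ : ℕ∞) (fun y => v (t + s', y)) :=
        hv.comp (contDiff_const.prodMk contDiff_id)
      rw [iteratedFDeriv_comp hvs.contDiffAt (hsm s').contDiffAt hk]
      simp only [FormalMultilinearSeries.taylorComp]
      rw [sum_apply]
      refine (norm_sum_le _ _).trans ?_
      have hterm : ∀ c : OrderedFinpartition n,
          ‖(ftaylorSeries ℝ (fun y => v (t + s', y)) (P s' x)).compAlongOrderedFinpartition
            (ftaylorSeries ℝ (P s') x) c m‖ ≤ a * ‖iteratedFDeriv ℝ n (P s') x m‖ + ε0 := by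
        intro c
        have hlen : 1 ≤ c.length := c.length_pos hj1
        have hvl := hvb c.length hlen c.length_le (t + s') (P s' x)
        rcases Nat.lt_or_ge 1 c.length with h2 | h2
        · have h3 : ‖(ftaylorSeries ℝ (fun y => v (t + s', y)) (P s' x)).compAlongOrderedFinpartition
            (ftaylorSeries ℝ (P s') x) c‖ ≤ a * (G ^ n * W n) := by
            refine (c.norm_compAlongOrderedFinpartition_le _ _).trans ?_
            have h4 : ∏ i, ‖ftaylorSeries ℝ (P s') x (c.partSize i)‖ ≤
                ∏ i, (G * W (c.partSize i)) := by
              refine Finset.prod_le_prod (fun _ _ => norm_nonneg _) fun i _ => ?_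
              have h5 := hprev (c.partSize i) (c.partSize_pos i)
                (by have := ofp_lt c h2 i; omega) s' x
              refine h5.trans ?_
              have := hW0 (c.partSize i)
              rw [hG]
              gcongr
            rw [Finset.prod_mul_distrib, Finset.prod_const, Finset.card_univ, Fintype.card_fin] at h4
            have hWp : 0 ≤ ∏ i, W (c.partSize i) := Finset.prod_nonneg fun i _ => (hW0 _).le
            have hWl := hW0 c.length
            calc _ ≤ (a * W c.length) * (G ^ c.length * ∏ i, W (c.partSize i)) := by
                  gcongr
                  exact hvl
              _ = a * (G ^ c.length * (W c.length * ∏ i, W (c.partSize i))) := by ring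
              _ ≤ a * (G ^ n * W n) := by
                  gcongr
                  · exact c.length_le
                  · exact hsub n hj1 c
          have h6 := ContinuousMultilinearMap.le_of_opNorm_le h3 m
          refine h6.trans ?_
          rw [hε0]
          have : 0 ≤ a * ‖iteratedFDeriv ℝ n (P s') x m‖ := by positivity
          linarith
        · have h1 : c.length = 1 := by omega
          rw [FormalMultilinearSeries.compAlongOrderedFinpartition_apply]
          have h3 := ContinuousMultilinearMap.le_of_opNorm_le hvl
            (c.applyOrderedFinpartition (fun m ↦ (ftaylorSeries ℝ (P s') x (c.partSize m))) m)
          have h4 : ∏ i, ‖c.applyOrderedFinpartition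
              (fun m ↦ (ftaylorSeries ℝ (P s') x (c.partSize m))) m i‖ =
              ‖iteratedFDeriv ℝ n (P s') x m‖ := by
            have : ∀ i, c.applyOrderedFinpartition
              (fun m ↦ (ftaylorSeries ℝ (P s') x (c.partSize m))) m i =
              iteratedFDeriv ℝ n (P s') x m := fun i =>
              ofp_single c h1 (ftaylorSeries ℝ (P s') x) m i
            simp only [this, Finset.prod_const, Finset.card_univ, Fintype.card_fin, h1, pow_one]
          have hWl : W c.length = 1 := by rw [h1, hW1]
          rw [h4, hWl, mul_one] at h3
          exact h3.trans (by linarith)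
      refine (Finset.sum_le_sum fun c _ => hterm c).trans ?_
      rw [Finset.sum_const, Finset.card_univ, nsmul_eq_mul]
      rw [hQ]
      apply le_of_eq
      ring
    have hinit : ‖iteratedFDeriv ℝ n (P 0) x m‖ ≤ pm := by
      have : P 0 = fun y => y := funext hP0
      rw [this]
      simpa using ContinuousMultilinearMap.le_of_opNorm_le (iter_id_le n hj1 x) m
    have hfin := gron (fun s => iteratedFDeriv ℝ n (P s) x m) _ s (mul_pos hQ0 ha)
      (mul_nonneg hQ0.le hε00)
      (fun s => flow_iter_hasDerivAt t hv ha hΛ P hP0 hd s n x m) hinit hbound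
    refine hfin.trans ?_
    have hdiv : Q * ε0 / (Q * a) = G ^ n * W n * pm := by
      rw [hε0]; field_simp
    rw [hdiv]
    have hGn : G ^ n = C ^ n * Real.exp (n * C * a * |s|) := by
      rw [hG, mul_pow, ← Real.exp_nat_mul]; ring_nf
    have hW1n := hW n
    have hGn1 : 1 ≤ G ^ n := one_le_pow₀ hG1
    have hGW : 1 ≤ G ^ n * W n := by nlinarith
    calc (pm + G ^ n * W n * pm) * Real.exp (Q * a * |s|)
        ≤ (2 * (G ^ n * W n * pm)) * Real.exp (Q * a * |s|) := by
          gcongr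
          nlinarith
      _ = 2 * C ^ n * Real.exp ((n * C + Q) * a * |s|) * W n * pm := by
          rw [hGn, show (n * C + Q) * a * |s| = n * C * a * |s| + Q * a * |s| by ring, Real.exp_add]
          ring
      _ ≤ C' * Real.exp (C' * a * |s|) * W n * pm := by
          have hWn := hW0 n
          gcongr
          · rw [hC']; linarith
          · rw [hC']; linarith

theorem max_sum (L : ℝ) (hL : 1 ≤ L) {ι : Type} (S : Finset ι) (p : ι → ℕ) (hp : ∀ i, 1 ≤ p i)
    (A : ℝ) (hA : 1 ≤ A) :
    max (A - L) 0 + ∑ i ∈ S, max ((p i : ℝ) - L) 0 ≤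
      max (A + ∑ i ∈ S, ((p i : ℝ) - 1) - L) 0 := by
  classical
  induction S using Finset.induction_on with
  | empty => simp
  | insert i S hi ih =>
    rw [Finset.sum_insert hi, Finset.sum_insert hi]
    have h1 : (1 : ℝ) ≤ p i := by exact_mod_cast hp i
    have h2 : 0 ≤ ∑ i ∈ S, ((p i : ℝ) - 1) := Finset.sum_nonneg fun j _ => by
      have : (1 : ℝ) ≤ p j := by exact_mod_cast hp j
      linarith
    generalize ∑ i ∈ S, ((p i : ℝ) - 1) = B at *
    have h3 : max (A + B - L) 0 + max ((p i : ℝ) - L) 0 ≤ max (A + (p i - 1 + B) - L) 0 := by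
      rcases max_cases (A + B - L) 0 with h | h <;>
      rcases max_cases ((p i : ℝ) - L) 0 with h' | h' <;>
      rcases max_cases (A + (p i - 1 + B) - L) 0 with h'' | h'' <;> linarith
    linarith

/-- The weight. -/
def wt (L : ℕ) (Ξ N : ℝ) (j : ℕ) : ℝ := N ^ (max ((j : ℝ) - L) 0 / L) * Ξ ^ (j - 1)

theorem wt_sub (L : ℕ) (hL : 1 ≤ L) (Ξ N : ℝ) (hΞ : 1 ≤ Ξ) (hN : 1 ≤ N) (n : ℕ) (hn : 1 ≤ n)
    (c : OrderedFinpartition n) :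
    wt L Ξ N c.length * ∏ i, wt L Ξ N (c.partSize i) ≤ wt L Ξ N n := by
  have hN0 : 0 < N := by linarith
  have hL' : (1 : ℝ) ≤ L := by exact_mod_cast hL
  have hlen : 1 ≤ c.length := c.length_pos hn
  have hs := ofp_sum c
  have hs1 : ∑ i, (c.partSize i - 1) + c.length = n := by
    have : ∑ i, (c.partSize i - 1) + ∑ i : Fin c.length, 1 = ∑ i, c.partSize i := by
      rw [← Finset.sum_add_distrib]
      exact Finset.sum_congr rfl fun i _ => Nat.sub_add_cancel (c.partSize_pos i)
    rw [hs] at this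
    simpa using this
  have hs2 : (c.length : ℝ) + ∑ i, ((c.partSize i : ℝ) - 1) = n := by
    rw [Finset.sum_sub_distrib, ← Nat.cast_sum, hs]
    simp
  unfold wt
  rw [Finset.prod_mul_distrib, Finset.prod_pow_eq_pow_sum, ← Real.rpow_sum_of_pos hN0]
  have e1 : N ^ (max ((c.length : ℝ) - L) 0 / L) *
      N ^ (∑ i, max ((c.partSize i : ℝ) - L) 0 / L) ≤ N ^ (max ((n : ℝ) - L) 0 / L) := by
    rw [← Real.rpow_add hN0]
    refine Real.rpow_le_rpow_of_exponent_le hN ?_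
    rw [← Finset.sum_div, ← add_div]
    gcongr
    have := max_sum L hL' Finset.univ c.partSize c.partSize_pos c.length (by exact_mod_cast hlen)
    rwa [hs2] at this
  have e2 : Ξ ^ (c.length - 1) * Ξ ^ (∑ i, (c.partSize i - 1)) = Ξ ^ (n - 1) := by
    rw [← pow_add]; congr 1; omega
  have hp : 0 ≤ Ξ ^ (n - 1) := by positivity
  calc _ = (N ^ (max ((c.length : ℝ) - L) 0 / L) *
      N ^ (∑ i, max ((c.partSize i : ℝ) - L) 0 / L)) *
      (Ξ ^ (c.length - 1) * Ξ ^ (∑ i, (c.partSize i - 1))) := by ring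
    _ ≤ _ := by rw [e2]; gcongr

end Bounds

/-- Estimates for spatial derivatives of the coarse scale flow: if the spatial
derivatives of `v` satisfy `‖∇^k v‖ ≤ Ξ^k N^{(k−L)₊/L} e_v^{1/2}`, then the
spatial derivatives of the flow map satisfy
`‖∇ₓ^k Φ_s‖ ≤ C₁ e^{C₂ Ξ e_v^{1/2}|s|} N^{(k−L)₊/L} Ξ^{k−1}`, with `C₁, C₂`
depending only on `k` and `L`; in particular they are bounded by
`C N^{(k−L)₊/L} Ξ^{k−1}` for `|s| ≤ Ξ⁻¹ e_v^{−1/2}`. -/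
theorem coarse_scale_flow_derivative_bounds (L M : ℕ) (hL : 1 ≤ L) (hM : 1 ≤ M)
    (k : ℕ) (hk1 : 1 ≤ k) (hkM : k ≤ M) :
    ∃ C₁ C₂ : ℝ, 0 < C₁ ∧ 0 < C₂ ∧
      ∀ (Ξ ev N : ℝ), 1 ≤ Ξ → 0 < ev → 1 ≤ N →
      ∀ v : ℝ → Spc → Spc,
        ContDiff ℝ (⊤ : ℕ∞) (fun q : ℝ × Spc => v q.1 q.2) →
        (∀ t, Per (v t)) →
        (∀ k' : ℕ, 1 ≤ k' → k' ≤ M → ∀ t x l,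
          ‖iteratedFDeriv ℝ k' (fun y => v t y l) x‖ ≤
            Ξ ^ k' * N ^ (max ((k' : ℝ) - L) 0 / L) * Real.sqrt ev) →
      ∀ Φ : ℝ → ℝ → Spc → Spc,
        (∀ t x, Φ 0 t x = x) →
        (∀ s t x, HasDerivAt (fun s' => Φ s' t x) (v (t + s) (Φ s t x)) s) →
      ∀ (s t : ℝ) (x : Spc),
        (‖iteratedFDeriv ℝ k (Φ s t) x‖ ≤
          C₁ * Real.exp (C₂ * Ξ * Real.sqrt ev * |s|) *
            N ^ (max ((k : ℝ) - L) 0 / L) * Ξ ^ (k - 1)) ∧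
        (|s| ≤ Ξ⁻¹ * (Real.sqrt ev)⁻¹ →
          ‖iteratedFDeriv ℝ k (Φ s t) x‖ ≤
            C₁ * Real.exp C₂ * N ^ (max ((k : ℝ) - L) 0 / L) * Ξ ^ (k - 1)) := by
  obtain ⟨C, hC1, hC⟩ := abs_bound (E := Spc) k
  refine ⟨C, C, by linarith, by linarith, ?_⟩
  intro Ξ ev N hΞ hev hN v hv _ hvb Φ hΦ0 hΦ s t x
  have hse : 0 < Real.sqrt ev := Real.sqrt_pos.2 hev
  have hΞ0 : 0 < Ξ := by linarith
  have hN0 : 0 < N := by linarith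
  have hL' : (1 : ℝ) ≤ L := by exact_mod_cast hL
  have hW1 : wt L Ξ N 1 = 1 := by
    have : max (((1 : ℕ) : ℝ) - L) 0 = 0 := max_eq_right (by push_cast; linarith)
    rw [wt, this]; simp
  have hW : ∀ j, 1 ≤ wt L Ξ N j := by
    intro j
    have h1 : 1 ≤ N ^ (max ((j : ℝ) - L) 0 / L) := Real.one_le_rpow hN (by positivity)
    have h2 : 1 ≤ Ξ ^ (j - 1) := one_le_pow₀ hΞ
    unfold wt
    nlinarith
  have hvb' : ∀ j, 1 ≤ j → j ≤ k → ∀ t x,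
      ‖iteratedFDeriv ℝ j (fun y => v t y) x‖ ≤ (Ξ * Real.sqrt ev) * wt L Ξ N j := by
    intro j hj1 hjk t x
    have hvt : ContDiff ℝ (⊤ : ℕ∞) (fun y => v t y) :=
      hv.comp (contDiff_const.prodMk contDiff_id)
    have hnn : 0 ≤ (Ξ * Real.sqrt ev) * wt L Ξ N j := by
      have := hW j
      positivity
    refine ContinuousMultilinearMap.opNorm_le_bound hnn fun m => ?_
    have hpm : 0 ≤ ∏ i, ‖m i‖ := Finset.prod_nonneg fun i _ => norm_nonneg _
    rw [pi_norm_le_iff_of_nonneg (mul_nonneg hnn hpm)]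
    intro l
    have hj : ((j : ℕ) : WithTop ℕ∞) ≤ ((⊤ : ℕ∞) : WithTop ℕ∞) := by
      exact_mod_cast le_top
    have h1 := (ContinuousLinearMap.proj (R := ℝ) (φ := fun _ : Fin 3 => ℝ) l).iteratedFDeriv_comp_left
      (hvt.contDiffAt (x := x)) hj
    have h2 := hvb j hj1 (hjk.trans hkM) t x l
    have h3 := ContinuousMultilinearMap.le_of_opNorm_le h2 m
    have h4 : iteratedFDeriv ℝ j (fun y => v t y l) x m =
        iteratedFDeriv ℝ j (fun y => v t y) x m l := congrArg (fun B => B m) h1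
    rw [h4] at h3
    refine h3.trans (le_of_eq ?_)
    unfold wt
    have h5 : Ξ ^ j = Ξ * Ξ ^ (j - 1) := by
      rw [← pow_succ']; congr 1; omega
    rw [h5]; ring
  have main := hC (wt L Ξ N) (Ξ * Real.sqrt ev) (fun q => v q.1 q.2) (by positivity) hW1 hW
    (wt_sub L hL Ξ N hΞ hN) hv hvb' t (fun s => Φ s t) (hΦ0 t) (fun s x => hΦ s t x) k hk1 le_rfl s x
  have first : ‖iteratedFDeriv ℝ k (Φ s t) x‖ ≤
          C * Real.exp (C * Ξ * Real.sqrt ev * |s|) *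
            N ^ (max ((k : ℝ) - L) 0 / L) * Ξ ^ (k - 1) := by
    refine main.trans (le_of_eq ?_)
    unfold wt
    rw [← mul_assoc C Ξ]
    ring
  refine ⟨first, fun hs => first.trans ?_⟩
  gcongr
  have h6 : Ξ * Real.sqrt ev * |s| ≤ 1 := by
    calc Ξ * Real.sqrt ev * |s| ≤ Ξ * Real.sqrt ev * (Ξ⁻¹ * (Real.sqrt ev)⁻¹) := by gcongr
      _ = 1 := by field_simp
  calc C * Ξ * Real.sqrt ev * |s| = C * (Ξ * Real.sqrt ev * |s|) := by ring
    _ ≤ C * 1 := by gcongr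
    _ = C := mul_one C
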